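/- Fix a real number m > 0 and an integer n ≥ 2. Let ε > 0, R < ∞, δ > 0, B < ∞, and let (φ_j) be a sequence of nonnegative smooth compactly supported functions (0,∞) × ℝⁿ → ℝ with ‖φ_j‖_{Ḣ¹} ≤ B for all j and Λ({(ρ,x) : φ_j(ρ,x) > ε and ρ ≤ R}) ≥ δ for all j. Then there exist δ' > 0 and points x_j ∈ ℝⁿ such that for all j: Λ({(ρ,x) : ρ ≤ R + 1, |x − x_j| < 1, and φ_j(ρ,x) ≥ ε/2}) ≥ δ'. -/

import Mathlib

open MeasureTheory

noncomputable section

/-- Generalized surface area of the unit `(m−1)`-sphere, `ω_m = 2π^{m/2}/Γ(m/2)`. -/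
def omegaConst (m : ℝ) : ℝ := 2 * Real.pi ^ (m / 2) / Real.Gamma (m / 2)

/-- The measure `Λ` on `(0,∞) × ℝⁿ` given by `dΛ = ω_m ρ^{m−1} dρ dx`. -/
def cylMeasure (m : ℝ) (n : ℕ) : Measure (ℝ × EuclideanSpace ℝ (Fin n)) :=
  (((volume : Measure ℝ).restrict (Set.Ioi 0)).withDensity
      (fun ρ => ENNReal.ofReal (omegaConst m * ρ ^ (m - 1)))).prod
    (volume : Measure (EuclideanSpace ℝ (Fin n)))

/-- The critical exponent `2* = 2(m+n)/(m+n−2)`. -/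
def twoStar (m : ℝ) (n : ℕ) : ℝ := 2 * (m + n) / (m + n - 2)

/-- The exponent `γ = (m+n−2)/2`. -/
def gammaExp (m : ℝ) (n : ℕ) : ℝ := (m + n - 2) / 2

/-- The `L^p(Λ)` norm of a complex-valued cylindrically symmetric function. -/
def cylLpNorm (m : ℝ) (n : ℕ) (p : ℝ) (φ : ℝ × EuclideanSpace ℝ (Fin n) → ℂ) : ℝ :=
  (∫ z, ‖φ z‖ ^ p ∂(cylMeasure m n)) ^ (1 / p)

/-- Pointwise squared gradient `|∂_ρ φ|² + |∇_x φ|²`. -/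
def cylGradSq (n : ℕ) (φ : ℝ × EuclideanSpace ℝ (Fin n) → ℂ)
    (z : ℝ × EuclideanSpace ℝ (Fin n)) : ℝ :=
  ‖fderiv ℝ φ z (1, 0)‖ ^ 2 +
    ∑ i : Fin n, ‖fderiv ℝ φ z (0, EuclideanSpace.single i 1)‖ ^ 2

/-- The homogeneous Sobolev norm `‖φ‖_{Ḣ¹} = (∫ (|∂_ρ φ|² + |∇_x φ|²) dΛ)^{1/2}`. -/
def cylH1Norm (m : ℝ) (n : ℕ) (φ : ℝ × EuclideanSpace ℝ (Fin n) → ℂ) : ℝ :=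
  Real.sqrt (∫ z, cylGradSq n φ z ∂(cylMeasure m n))

/-- The extremal `F_{t,x₀}(ρ,x) = k₀ t^γ (1 + t²ρ² + t²|x−x₀|²)^{−γ}`. -/
def cylBubble (m : ℝ) (n : ℕ) (k₀ t : ℝ) (x₀ : EuclideanSpace ℝ (Fin n)) :
    ℝ × EuclideanSpace ℝ (Fin n) → ℂ :=
  fun z =>
    ((k₀ * t ^ gammaExp m n *
        (1 + t ^ 2 * z.1 ^ 2 + t ^ 2 * ‖z.2 - x₀‖ ^ 2) ^ (-(gammaExp m n)) : ℝ) : ℂ)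

/-- The distance `δ(φ, M) = inf_{z∈ℂ, t>0, x₀∈ℝⁿ} ‖φ − z F_{t,x₀}‖_{Ḣ¹}` from `φ` to
the manifold of extremals. -/
def cylDeltaM (m : ℝ) (n : ℕ) (k₀ : ℝ) (φ : ℝ × EuclideanSpace ℝ (Fin n) → ℂ) : ℝ :=
  ⨅ p : ℂ × {t : ℝ // 0 < t} × EuclideanSpace ℝ (Fin n),
    cylH1Norm m n (fun w => φ w - p.1 • cylBubble m n k₀ p.2.1.1 p.2.2 w)


open scoped ENNReal

lemma lieb_abs1 {α : Type*} [MeasurableSpace α] (ν : Measure α) (I J : Set α)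
    (_hI : MeasurableSet I) (hJ : MeasurableSet J) (hJI : J ⊆ I) (hJ0 : ν J ≠ 0) (hJt : ν J ≠ ⊤)
    (k : α → ℝ≥0∞) (hk : Measurable k) (hkI : ∫⁻ a in I, k a ∂ν ≠ ⊤) (c : ℝ≥0∞) (hc : c ≠ 0) :
    ∃ τ : ℝ≥0∞, τ ≠ 0 ∧ τ ≠ ⊤ ∧ ∀ G : Set α, MeasurableSet G → G ⊆ I → ν G < τ →
      ∀ (F : α → ℝ≥0∞) (E : ℝ≥0∞), Measurable F →
      (∀ a ∈ I, ∀ b ∈ J, F a ≤ 2 * F b + 2 * (k a * E)) →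
      ∫⁻ a in G, F a ∂ν ≤ c * (∫⁻ a in I, F a ∂ν + E) := by
  have hc2 : c / 2 ≠ 0 := by simp [hc]
  obtain ⟨τ1, hτ1, h1⟩ := exists_pos_setLIntegral_lt_of_measure_lt hkI hc2
  refine ⟨min 1 (min τ1 (c / 2 * ν J)), ?_, ?_, ?_⟩
  · have : (0 : ℝ≥0∞) < min 1 (min τ1 (c / 2 * ν J)) :=
      lt_min one_pos (lt_min hτ1 (pos_iff_ne_zero.2 (mul_ne_zero hc2 hJ0)))
    exact this.ne'
  · exact ((min_le_left _ _).trans_lt ENNReal.one_lt_top).ne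
  intro G hG hGI hGτ F E hF hyp
  have hG1 : ν G ≤ c / 2 * ν J := hGτ.le.trans ((min_le_right _ _).trans (min_le_right _ _))
  have hG2 : ∫⁻ a in G, k a ∂ν ≤ c / 2 := by
    have := h1 G (by
      rw [Measure.restrict_apply hG, Set.inter_eq_left.2 hGI]
      exact hGτ.trans_le ((min_le_right _ _).trans (min_le_left _ _)))
    rw [Measure.restrict_restrict hG, Set.inter_eq_left.2 hGI] at this
    exact this.le
  set X := ∫⁻ a in I, F a ∂ν with hX
  have key : ∀ a ∈ I, ν J * F a ≤ 2 * X + 2 * E * ν J * k a := by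
    intro a ha
    calc ν J * F a = ∫⁻ b in J, F a ∂ν := by simp [mul_comm]
      _ ≤ ∫⁻ b in J, (2 * F b + 2 * (k a * E)) ∂ν := setLIntegral_mono' hJ (hyp a ha)
      _ = 2 * ∫⁻ b in J, F b ∂ν + 2 * (k a * E) * ν J := by
        rw [lintegral_add_right _ measurable_const, lintegral_const_mul _ hF]; simp
      _ ≤ 2 * X + 2 * (k a * E) * ν J := by
        have : ∫⁻ b in J, F b ∂ν ≤ X := lintegral_mono_set hJI
        gcongr
      _ = _ := by ring
  have h2 : ν J * ∫⁻ a in G, F a ∂ν ≤ ν J * (c * (X + E)) := by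
    calc ν J * ∫⁻ a in G, F a ∂ν = ∫⁻ a in G, ν J * F a ∂ν := (lintegral_const_mul _ hF).symm
      _ ≤ ∫⁻ a in G, (2 * X + 2 * E * ν J * k a) ∂ν :=
        setLIntegral_mono' hG (fun a ha => key a (hGI ha))
      _ = 2 * X * ν G + 2 * E * ν J * ∫⁻ a in G, k a ∂ν := by
        rw [lintegral_add_left measurable_const, lintegral_const_mul _ hk]; simp
      _ ≤ 2 * X * (c / 2 * ν J) + 2 * E * ν J * (c / 2) := by gcongr
      _ = (2 * (c / 2)) * (ν J * (X + E)) := by ring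
      _ = ν J * (c * (X + E)) := by
        rw [ENNReal.mul_div_cancel (by simp) (by simp)]; ring
  exact (ENNReal.mul_le_mul_iff_right hJ0 hJt).1 h2

lemma lieb_abs2 {E : Type*} [NormedAddCommGroup E] [NormedSpace ℝ E] [MeasurableSpace E]
    [BorelSpace E] [FiniteDimensional ℝ E] (μ : Measure E) [μ.IsAddHaarMeasure]
    (c : ℝ≥0∞) (hc : c ≠ 0) :
    ∃ η : ℝ≥0∞, η ≠ 0 ∧ η ≠ ⊤ ∧ ∀ (x₀ : E) (S : Set E), MeasurableSet S → S ⊆ Metric.ball x₀ 1 →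
      μ S ≤ η → ∀ F H : E → ℝ≥0∞, Measurable F → Measurable H →
      (∀ x v, F x ≤ 2 * F (x + v) + 2 * (ENNReal.ofReal (‖v‖ ^ 2) *
        ∫⁻ t in Set.Ioc (0 : ℝ) 1, H (x + t • v))) →
      ∫⁻ x in S, F x ∂μ ≤ c * ∫⁻ x in Metric.ball x₀ 2, (F x + H x) ∂μ := by
  obtain ⟨r, hr0, hr1, hrc⟩ : ∃ r : ℝ, 0 < r ∧ r ≤ 1 ∧ 2 * ENNReal.ofReal (r ^ 2) ≤ c := by
    have : Filter.Tendsto (fun r : ℝ => 2 * ENNReal.ofReal (r ^ 2)) (nhdsWithin 0 (Set.Ioi 0))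
        (nhds 0) := by
      have h : Continuous (fun r : ℝ => 2 * ENNReal.ofReal (r ^ 2)) :=
        (ENNReal.continuous_const_mul (by simp)).comp
          (ENNReal.continuous_ofReal.comp (by fun_prop))
      have := h.tendsto 0
      simp at this
      exact this.mono_left nhdsWithin_le_nhds
    have h1 := this.eventually (ge_mem_nhds (pos_iff_ne_zero.2 hc))
    have h2 : ∀ᶠ r : ℝ in nhdsWithin 0 (Set.Ioi 0), r ∈ Set.Ioc (0:ℝ) 1 :=
      Ioc_mem_nhdsGT one_pos
    obtain ⟨r, hr, hr'⟩ := (h1.and h2).exists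
    exact ⟨r, hr'.1, hr'.2, hr⟩
  set β := μ (Metric.ball (0 : E) r) with hβ
  have hβ0 : β ≠ 0 := (Metric.measure_ball_pos μ _ hr0).ne'
  have hβt : β ≠ ⊤ := measure_ball_lt_top.ne
  refine ⟨min 1 (c / 2 * β), ?_, ?_, ?_⟩
  · have : (0 : ℝ≥0∞) < min 1 (c / 2 * β) :=
      lt_min one_pos (pos_iff_ne_zero.2 (mul_ne_zero (by simp [hc]) hβ0))
    exact this.ne'
  · exact ((min_le_left _ _).trans_lt ENNReal.one_lt_top).ne
  intro x₀ S hS hSB hSη F H hF hH hyp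
  have hSη := hSη.trans (min_le_right _ _)
  set D := Metric.ball x₀ 2
  have hD : MeasurableSet D := Metric.isOpen_ball.measurableSet
  set B := Metric.ball (0 : E) r
  have hB : MeasurableSet B := Metric.isOpen_ball.measurableSet
  have hin : ∀ x ∈ S, ∀ v ∈ B, ∀ t ∈ Set.Icc (0:ℝ) 1, x + t • v ∈ D := by
    intro x hx v hv t ht
    have h1 : ‖x - x₀‖ < 1 := by simpa [dist_eq_norm] using hSB hx
    have h2 : ‖v‖ < r := by simpa [B] using hv
    have h3 : ‖t • v‖ < 1 := by
      rw [norm_smul, Real.norm_of_nonneg ht.1]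
      nlinarith [ht.1, ht.2, norm_nonneg v]
    simp only [D, Metric.mem_ball, dist_eq_norm]
    calc ‖x + t • v - x₀‖ = ‖(x - x₀) + t • v‖ := by congr 1; abel
      _ ≤ ‖x - x₀‖ + ‖t • v‖ := norm_add_le _ _
      _ < 2 := by linarith
  -- translate integrals
  have htr : ∀ (f : E → ℝ≥0∞), Measurable f → ∀ v ∈ B, ∀ t ∈ Set.Icc (0:ℝ) 1,
      ∫⁻ x in S, f (x + t • v) ∂μ ≤ ∫⁻ x in D, f x ∂μ := by
    intro f hf v hv t ht
    rw [← lintegral_indicator hS, ← lintegral_indicator hD,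
      ← lintegral_add_right_eq_self (D.indicator f) (t • v)]
    refine lintegral_mono fun x => ?_
    by_cases hx : x ∈ S
    · simp [hx, hin x hx v hv t ht]
    · simp [hx]
  have m1 : Measurable (fun p : E × E => F (p.1 + p.2)) := by fun_prop
  have m2 : Measurable (fun p : (E × E) × ℝ => H (p.1.1 + p.2 • p.1.2)) := by fun_prop
  have m3 : Measurable (fun p : E × E => ∫⁻ t in Set.Ioc (0:ℝ) 1, H (p.1 + t • p.2)) :=
    m2.lintegral_prod_right'
  set X := ∫⁻ x in D, F x ∂μ with hX
  set Y := ∫⁻ x in D, H x ∂μ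
  have key : β * ∫⁻ x in S, F x ∂μ ≤ β * (c * (X + Y)) := by
    calc β * ∫⁻ x in S, F x ∂μ = ∫⁻ x in S, ∫⁻ v in B, F x ∂μ ∂μ := by
          rw [← lintegral_const_mul _ hF]; simp [hβ, mul_comm, B]
      _ ≤ ∫⁻ x in S, ∫⁻ v in B, (2 * F (x + v) + 2 * (ENNReal.ofReal (r ^ 2) *
            ∫⁻ t in Set.Ioc (0 : ℝ) 1, H (x + t • v))) ∂μ ∂μ := by
          refine lintegral_mono fun x => setLIntegral_mono' hB fun v hv => (hyp x v).trans ?_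
          have h2 : ‖v‖ < r := by simpa [B] using hv
          gcongr
      _ = 2 * (∫⁻ x in S, ∫⁻ v in B, F (x + v) ∂μ ∂μ) + 2 * (ENNReal.ofReal (r ^ 2) *
            ∫⁻ x in S, ∫⁻ v in B, (∫⁻ t in Set.Ioc (0 : ℝ) 1, H (x + t • v)) ∂μ ∂μ) := by
          rw [← lintegral_const_mul _ m1.lintegral_prod_right',
            ← lintegral_const_mul _ m3.lintegral_prod_right', ← lintegral_const_mul _
              (m3.lintegral_prod_right'.const_mul _), ← lintegral_add_left
              (m1.lintegral_prod_right'.const_mul _)]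
          refine lintegral_congr fun x => ?_
          rw [lintegral_add_left (by fun_prop), lintegral_const_mul _ (by fun_prop),
            lintegral_const_mul _ (by exact (m3.comp measurable_prodMk_left).const_mul _),
            lintegral_const_mul _ (by exact (m3.comp measurable_prodMk_left))]
      _ ≤ 2 * (μ S * X) + 2 * (ENNReal.ofReal (r ^ 2) * (Y * β)) := by
          gcongr
          · calc _ ≤ ∫⁻ x in S, X ∂μ := by
                  refine setLIntegral_mono' hS fun x hx => ?_
                  rw [hX, ← lintegral_indicator hB, ← lintegral_indicator hD,
                    ← lintegral_add_left_eq_self (D.indicator F) x]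
                  refine lintegral_mono fun v => ?_
                  by_cases hv : v ∈ B
                  · have := hin x hx v hv 1 (by simp)
                    simp at this
                    simp [hv, this]
                  · simp [hv]
              _ = _ := by simp [mul_comm]
          · rw [lintegral_lintegral_swap (by exact m3.aemeasurable)]
            calc _ ≤ ∫⁻ v in B, Y ∂μ := by
                  refine setLIntegral_mono' hB fun v hv => ?_
                  rw [lintegral_lintegral_swap (by
                    refine Measurable.aemeasurable ?_
                    show Measurable (fun p : E × ℝ => H (p.1 + p.2 • v))
                    fun_prop)]
                  calc _ ≤ ∫⁻ t in Set.Ioc (0:ℝ) 1, Y := by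
                        refine setLIntegral_mono' measurableSet_Ioc fun t ht => ?_
                        exact htr H hH v hv t ⟨ht.1.le, ht.2⟩
                    _ = Y := by simp
              _ = _ := by simp [hβ, B]
      _ ≤ 2 * (c / 2 * β * X) + c * (Y * β) := by
          rw [← mul_assoc 2 (ENNReal.ofReal (r^2))]
          gcongr
      _ = (2 * (c / 2)) * β * X + c * (Y * β) := by ring
      _ = _ := by rw [ENNReal.mul_div_cancel (by simp) (by simp)]; ring
  rw [lintegral_add_left hF]
  exact (ENNReal.mul_le_mul_iff_right hβ0 hβt).1 key

lemma lieb_abs3 {α E : Type*} [MeasurableSpace α] [NormedAddCommGroup E] [NormedSpace ℝ E]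
    [MeasurableSpace E]
    [BorelSpace E] [FiniteDimensional ℝ E] (ν : Measure α) [SFinite ν]
    (μ : Measure E) [μ.IsAddHaarMeasure]
    (I J : Set α)
    (hI : MeasurableSet I) (hJ : MeasurableSet J) (hJI : J ⊆ I) (hJ0 : ν J ≠ 0) (hJt : ν J ≠ ⊤)
    (k : α → ℝ≥0∞) (hk : Measurable k) (hkI : ∫⁻ a in I, k a ∂ν ≠ ⊤)
    (c : ℝ≥0∞) (hc : c ≠ 0) :
    ∃ s : ℝ≥0∞, s ≠ 0 ∧ s ≠ ⊤ ∧ ∀ (x₀ : E) (F H : α × E → ℝ≥0∞), Measurable F → Measurable H →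
      (∀ x, ∀ a ∈ I, ∀ b ∈ J, F (a, x) ≤ 2 * F (b, x) + 2 * (k a * ∫⁻ t in I, H (t, x) ∂ν)) →
      (∀ a x v, F (a, x) ≤ 2 * F (a, x + v) + 2 * (ENNReal.ofReal (‖v‖ ^ 2) *
        ∫⁻ t in Set.Ioc (0 : ℝ) 1, H (a, x + t • v))) →
      (ν.prod μ) {z | z.1 ∈ I ∧ z.2 ∈ Metric.ball x₀ 1 ∧ F z ≠ 0} < s →
      ∫⁻ z in I ×ˢ Metric.ball x₀ 1, F z ∂(ν.prod μ) ≤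
        c * ∫⁻ z in I ×ˢ Metric.ball x₀ 2, (F z + H z) ∂(ν.prod μ) := by
  have hc2 : c / 2 ≠ 0 := by simp [hc]
  obtain ⟨τ, hτ0, hτt, h1⟩ := lieb_abs1 ν I J hI hJ hJI hJ0 hJt k hk hkI (c / 2) hc2
  obtain ⟨η, hη0, hηt, h2⟩ := lieb_abs2 μ (c / 2) hc2
  refine ⟨τ * η, mul_ne_zero hτ0 hη0, ENNReal.mul_ne_top hτt hηt, ?_⟩
  intro x₀ F H hF hH hyp1 hyp2 hs
  set S := {z : α × E | z.1 ∈ I ∧ z.2 ∈ Metric.ball x₀ 1 ∧ F z ≠ 0} with hSdef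
  have hB1 : MeasurableSet (Metric.ball x₀ (1:ℝ)) := Metric.isOpen_ball.measurableSet
  have hB2 : MeasurableSet (Metric.ball x₀ (2:ℝ)) := Metric.isOpen_ball.measurableSet
  have hS : MeasurableSet S := by
    have e : S = (I ×ˢ Metric.ball x₀ 1) ∩ (F ⁻¹' {0})ᶜ := by
      ext z; simp [S, and_assoc]
    rw [e]
    exact (hI.prod hB1).inter (hF (measurableSet_singleton 0)).compl
  have hsl : Measurable fun a => μ (Prod.mk a ⁻¹' S) := measurable_measure_prodMk_left hS
  set G := I ∩ {a | η ≤ μ (Prod.mk a ⁻¹' S)} with hG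
  have hGm : MeasurableSet G := hI.inter (measurableSet_le measurable_const hsl)
  have hGτ : ν G < τ := by
    have hm := mul_meas_ge_le_lintegral hsl η (μ := ν)
    rw [← Measure.prod_apply hS] at hm
    have : η * ν G < η * τ := by
      calc η * ν G ≤ η * ν {a | η ≤ μ (Prod.mk a ⁻¹' S)} := by
            gcongr; exact Set.inter_subset_right
        _ ≤ _ := hm
        _ < τ * η := hs
        _ = _ := mul_comm _ _
    exact lt_of_mul_lt_mul_left' this
  have hFH : Measurable (fun z => F z + H z) := hF.add hH
  set T := ∫⁻ z in I ×ˢ Metric.ball x₀ 2, (F z + H z) ∂(ν.prod μ) with hT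
  have hTeq : T = ∫⁻ a in I, ∫⁻ x in Metric.ball x₀ 2, (F (a, x) + H (a, x)) ∂μ ∂ν := by
    rw [hT, setLIntegral_prod _ hFH.aemeasurable]
  have p1 : ∫⁻ a in G, ∫⁻ x in Metric.ball x₀ 1, F (a, x) ∂μ ∂ν ≤ c / 2 * T := by
    rw [lintegral_lintegral_swap (by exact hF.aemeasurable)]
    calc _ ≤ ∫⁻ x in Metric.ball x₀ 1, c / 2 * (∫⁻ a in I, F (a, x) ∂ν + ∫⁻ a in I, H (a, x) ∂ν) ∂μ := by
          refine lintegral_mono fun x => ?_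
          exact h1 G hGm Set.inter_subset_left hGτ (fun a => F (a, x)) _
            (hF.comp measurable_prodMk_right) (hyp1 x)
      _ = c / 2 * ∫⁻ x in Metric.ball x₀ 1, ∫⁻ a in I, (F (a, x) + H (a, x)) ∂ν ∂μ := by
          rw [← lintegral_const_mul _ hFH.lintegral_prod_left']
          refine lintegral_congr fun x => ?_
          rw [lintegral_add_left (by exact hF.comp measurable_prodMk_right)]
      _ ≤ c / 2 * ∫⁻ x in Metric.ball x₀ 2, ∫⁻ a in I, (F (a, x) + H (a, x)) ∂ν ∂μ := by
          gcongr
          norm_num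
      _ = _ := by
          rw [hTeq]
          congr 1
          exact (lintegral_lintegral_swap (f := fun (a : α) (x : E) => F (a, x) + H (a, x))
            (by exact hFH.aemeasurable)).symm
  have p2 : ∫⁻ a in I \ G, ∫⁻ x in Metric.ball x₀ 1, F (a, x) ∂μ ∂ν ≤ c / 2 * T := by
    calc _ ≤ ∫⁻ a in I \ G, c / 2 * ∫⁻ x in Metric.ball x₀ 2, (F (a, x) + H (a, x)) ∂μ ∂ν := by
          refine setLIntegral_mono' (hI.diff hGm) fun a ha => ?_
          have hle : μ (Prod.mk a ⁻¹' S) ≤ η := by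
            by_contra hcon
            exact ha.2 ⟨ha.1, (not_le.1 hcon).le⟩
          have hSa : MeasurableSet (Prod.mk a ⁻¹' S) := measurable_prodMk_left hS
          have hsub : Prod.mk a ⁻¹' S ⊆ Metric.ball x₀ 1 := fun x hx => hx.2.1
          have := h2 x₀ _ hSa hsub hle (fun x => F (a, x)) (fun x => H (a, x))
            (hF.comp measurable_prodMk_left) (hH.comp measurable_prodMk_left) (hyp2 a)
          refine le_trans (le_of_eq ?_) this
          rw [← lintegral_indicator hB1, ← lintegral_indicator hSa]
          refine lintegral_congr fun x => ?_
          by_cases hx : x ∈ Metric.ball x₀ 1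
          · by_cases hf : F (a, x) = 0
            · simp [Set.indicator, hf]
            · have : x ∈ Prod.mk a ⁻¹' S := ⟨ha.1, hx, hf⟩
              rw [Set.indicator_of_mem hx, Set.indicator_of_mem this]
          · rw [Set.indicator_of_notMem hx, Set.indicator_of_notMem (fun h => hx (hsub h))]
      _ ≤ ∫⁻ a in I, c / 2 * ∫⁻ x in Metric.ball x₀ 2, (F (a, x) + H (a, x)) ∂μ ∂ν :=
          lintegral_mono_set Set.sdiff_subset
      _ = _ := by rw [hTeq, lintegral_const_mul _ hFH.lintegral_prod_right']
  rw [setLIntegral_prod _ hF.aemeasurable]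
  have hGI : G ⊆ I := Set.inter_subset_left
  calc _ = ∫⁻ a in G, ∫⁻ x in Metric.ball x₀ 1, F (a, x) ∂μ ∂ν +
        ∫⁻ a in I \ G, ∫⁻ x in Metric.ball x₀ 1, F (a, x) ∂μ ∂ν := by
        rw [← lintegral_union (hI.diff hGm) Set.disjoint_sdiff_right, Set.union_sdiff_cancel hGI]
    _ ≤ c / 2 * T + c / 2 * T := add_le_add p1 p2
    _ = c * T := by rw [← add_mul, ENNReal.add_halves]

/-- selection of a good center -/
lemma lieb_select {α E : Type*} [MeasurableSpace α] [NormedAddCommGroup E] [NormedSpace ℝ E]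
    [MeasurableSpace E]
    [BorelSpace E] [FiniteDimensional ℝ E] (ν : Measure α) [SFinite ν]
    (μ : Measure E) [μ.IsAddHaarMeasure] (I : Set α) (hI : MeasurableSet I)
    (K : ℝ≥0∞) (hK : K ≠ ⊤) (F H : α × E → ℝ≥0∞) (hF : Measurable F) (hH : Measurable H)
    (h0 : ∫⁻ z in I ×ˢ Set.univ, F z ∂(ν.prod μ) ≠ 0)
    (ht : ∫⁻ z in I ×ˢ Set.univ, F z ∂(ν.prod μ) ≠ ⊤)
    (hHK : ∫⁻ z in I ×ˢ Set.univ, H z ∂(ν.prod μ) ≤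
      K * ∫⁻ z in I ×ˢ Set.univ, F z ∂(ν.prod μ)) :
    ∃ x₀ : E, ∫⁻ z in I ×ˢ Metric.ball x₀ 1, F z ∂(ν.prod μ) ≠ 0 ∧
      ∫⁻ z in I ×ˢ Metric.ball x₀ 2, (F z + H z) ∂(ν.prod μ) ≤
        ((1 + K) * μ (Metric.ball 0 2) / μ (Metric.ball 0 1) + 1) *
          ∫⁻ z in I ×ˢ Metric.ball x₀ 1, F z ∂(ν.prod μ) := by
  have hgen : ∀ (f : α × E → ℝ≥0∞), Measurable f → ∀ r : ℝ,
      ∫⁻ x₀, (∫⁻ z in I ×ˢ Metric.ball x₀ r, f z ∂(ν.prod μ)) ∂μ =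
        μ (Metric.ball 0 r) * ∫⁻ z in I ×ˢ Set.univ, f z ∂(ν.prod μ) := by
    intro f hf r
    have hb : ∀ x₀ : E, MeasurableSet (Metric.ball x₀ r) :=
      fun x₀ => Metric.isOpen_ball.measurableSet
    have hI' : MeasurableSet (I ×ˢ (Set.univ : Set E)) := hI.prod MeasurableSet.univ
    have hW : MeasurableSet {p : E × (α × E) | dist p.2.2 p.1 < r} :=
      measurableSet_lt (by fun_prop) measurable_const
    have e1 : ∀ x₀ : E, ∫⁻ z in I ×ˢ Metric.ball x₀ r, f z ∂(ν.prod μ) =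
        ∫⁻ z in I ×ˢ Set.univ, ({p : E × (α × E) | dist p.2.2 p.1 < r}).indicator
          (fun p => f p.2) (x₀, z) ∂(ν.prod μ) := by
      intro x₀
      rw [← lintegral_indicator (hI.prod (hb x₀)), ← lintegral_indicator hI']
      refine lintegral_congr fun z => ?_
      by_cases h1 : z.1 ∈ I <;> by_cases h2 : dist z.2 x₀ < r <;>
        simp [Set.indicator, h1, h2]
    simp_rw [e1]
    rw [lintegral_lintegral_swap (by
      exact ((hf.comp measurable_snd).indicator hW).aemeasurable), ← lintegral_const_mul _ hf]
    refine lintegral_congr fun z => ?_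
    calc _ = ∫⁻ x, (Metric.ball z.2 r).indicator (fun _ => f z) x ∂μ := by
          refine lintegral_congr fun x => ?_
          simp [Set.indicator, dist_comm]
      _ = _ := by
          rw [lintegral_indicator (hb _), lintegral_const, Measure.restrict_apply_univ,
            Measure.addHaar_ball_center, mul_comm]
  by_contra hcon
  push Not at hcon
  set b1 := μ (Metric.ball (0:E) 1) with hb1
  set b2 := μ (Metric.ball (0:E) 2)
  have hb10 : b1 ≠ 0 := (Metric.measure_ball_pos μ _ one_pos).ne'
  have hb1t : b1 ≠ ⊤ := measure_ball_lt_top.ne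
  have hb2t : b2 ≠ ⊤ := measure_ball_lt_top.ne
  set C := (1 + K) * b2 / b1 + 1 with hC
  have hCt : C ≠ ⊤ := by
    refine ENNReal.add_ne_top.2 ⟨ENNReal.div_ne_top (ENNReal.mul_ne_top ?_ hb2t) hb10, by simp⟩
    exact ENNReal.add_ne_top.2 ⟨by simp, hK⟩
  set X := ∫⁻ z in I ×ˢ Set.univ, F z ∂(ν.prod μ)
  have hle : ∀ x₀, C * ∫⁻ z in I ×ˢ Metric.ball x₀ 1, F z ∂(ν.prod μ) ≤
      ∫⁻ z in I ×ˢ Metric.ball x₀ 2, (F z + H z) ∂(ν.prod μ) := by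
    intro x₀
    by_cases h : ∫⁻ z in I ×ˢ Metric.ball x₀ 1, F z ∂(ν.prod μ) = 0
    · simp [h]
    · exact (hcon x₀ h).le
  have h1 := lintegral_mono (μ := μ) hle
  rw [lintegral_const_mul' _ _ hCt, hgen F hF, hgen (fun z => F z + H z) (hF.add hH), lintegral_add_left hF] at h1
  have h2 : C * (b1 * X) ≤ (1 + K) * b2 * X := by
    calc _ ≤ _ := h1
      _ ≤ b2 * (X + K * X) := by gcongr
      _ = _ := by ring
  have h3 : C * (b1 * X) = (1 + K) * b2 * X + b1 * X := by
    rw [hC, add_mul, one_mul, ← mul_assoc, ENNReal.div_mul_cancel hb10 hb1t]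
  rw [h3] at h2
  have h4 : (1 + K) * b2 * X ≠ ⊤ :=
    ENNReal.mul_ne_top (ENNReal.mul_ne_top (ENNReal.add_ne_top.2 ⟨by simp, hK⟩) hb2t) ht
  exact absurd h2 (not_le.2 (ENNReal.lt_add_right h4 (mul_ne_zero hb10 h0)))

lemma lieb_ftc (u u' : ℝ → ℝ) (hu : ∀ t, HasDerivAt u (u' t) t) (hc : Continuous u')
    (a b : ℝ) (hab : a ≤ b) :
    ENNReal.ofReal ((u b - u a) ^ 2) ≤
      ENNReal.ofReal (b - a) * ∫⁻ t in Set.Ioc a b, ENNReal.ofReal (u' t ^ 2) := by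
  rcases hab.eq_or_lt with rfl | hlt
  · simp
  have i1 : IntervalIntegrable u' volume a b := hc.intervalIntegrable _ _
  have i2 : IntervalIntegrable (fun t => u' t ^ 2) volume a b :=
    (hc.pow 2).intervalIntegrable _ _
  have e1 : ∫ t in a..b, u' t = u b - u a :=
    intervalIntegral.integral_eq_sub_of_hasDerivAt (fun t _ => hu t) i1
  have e2 : ENNReal.ofReal (∫ t in a..b, u' t ^ 2) =
      ∫⁻ t in Set.Ioc a b, ENNReal.ofReal (u' t ^ 2) := by
    rw [intervalIntegral.integral_of_le hab]
    exact ofReal_integral_eq_lintegral_ofReal i2.1 (Filter.Eventually.of_forall fun t => sq_nonneg _)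
  rw [← e2, ← ENNReal.ofReal_mul (by linarith)]
  apply ENNReal.ofReal_le_ofReal
  set c := (u b - u a) / (b - a) with hcdef
  have hcd : c * (b - a) = u b - u a := div_mul_cancel₀ _ (by linarith)
  have h0 : 0 ≤ ∫ t in a..b, (u' t - c) ^ 2 :=
    intervalIntegral.integral_nonneg hab (fun t _ => sq_nonneg _)
  have h1 : ∫ t in a..b, (u' t - c) ^ 2 =
      (∫ t in a..b, u' t ^ 2) - 2 * c * (u b - u a) + c ^ 2 * (b - a) := by
    have : ∀ t, (u' t - c) ^ 2 = u' t ^ 2 - 2 * c * u' t + c ^ 2 := fun t => by ring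
    simp_rw [this]
    rw [intervalIntegral.integral_add (i2.sub (i1.const_mul _)) (by simp),
      intervalIntegral.integral_sub i2 (i1.const_mul _), intervalIntegral.integral_const_mul, e1]
    simp [mul_comm]
  rw [h1] at h0
  have hpos : 0 < b - a := by linarith
  have h2 := mul_nonneg hpos.le h0
  nlinarith [h2, hcd]

def liebNu (m : ℝ) : Measure ℝ := ((volume : Measure ℝ).restrict (Set.Ioi 0)).withDensity
      (fun ρ => ENNReal.ofReal (omegaConst m * ρ ^ (m - 1)))

lemma lieb_cyl (m : ℝ) (n : ℕ) : cylMeasure m n = (liebNu m).prod volume := rfl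

instance lieb_sf (m : ℝ) : SFinite (liebNu m) := by unfold liebNu; infer_instance

lemma lieb_omega_pos (m : ℝ) (hm : 0 < m) : 0 < omegaConst m := by
  unfold omegaConst
  have := Real.Gamma_pos_of_pos (half_pos hm)
  positivity

lemma lieb_w_meas (m : ℝ) :
    Measurable (fun ρ : ℝ => ENNReal.ofReal (omegaConst m * ρ ^ (m - 1))) := by
  fun_prop

lemma lieb_nu_int (m a L : ℝ) (ha : 0 ≤ a) (f : ℝ → ℝ≥0∞) (hf : Measurable f) :
    ∫⁻ t in Set.Ioo a L, f t ∂(liebNu m) =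
      ∫⁻ t in Set.Ioo a L, ENNReal.ofReal (omegaConst m * t ^ (m - 1)) * f t := by
  unfold liebNu
  rw [setLIntegral_withDensity_eq_setLIntegral_mul _ (lieb_w_meas m) hf measurableSet_Ioo,
    Measure.restrict_restrict measurableSet_Ioo]
  have : Set.Ioo a L ∩ Set.Ioi 0 = Set.Ioo a L :=
    Set.inter_eq_left.2 fun x hx => lt_of_le_of_lt ha hx.1
  rw [this]; rfl

lemma lieb_rpow_int (m L : ℝ) (hm : 0 < m) (hL : 0 < L) (A C : ℝ) :
    ∫⁻ t in Set.Ioo 0 L, ENNReal.ofReal (A + C * t ^ (m - 1)) ≠ ⊤ := by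
  have h1 : IntegrableOn (fun t : ℝ => t ^ (m - 1)) (Set.Ioo 0 L) :=
    (intervalIntegral.integrableOn_Ioo_rpow_iff hL).2 (by linarith)
  have h2 : IntegrableOn (fun t : ℝ => A + C * t ^ (m - 1)) (Set.Ioo 0 L) :=
    (integrableOn_const (by simp)).add (h1.const_mul C)
  exact (h2.lintegral_lt_top).ne

lemma lieb_nu_nonpos (m : ℝ) : liebNu m (Set.Iic 0) = 0 := by
  unfold liebNu
  refine withDensity_absolutelyContinuous _ _ ?_
  rw [Measure.restrict_apply measurableSet_Iic, Set.Iic_inter_Ioi, Set.Ioc_self, measure_empty]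

lemma lieb_nu_Ioo (m L : ℝ) (hm : 0 < m) (hL : 0 < L) : liebNu m (Set.Ioo 0 L) ≠ ⊤ := by
  have h := lieb_nu_int m 0 L le_rfl (fun _ => 1) measurable_const
  simp only [lintegral_const, Measure.restrict_apply_univ, one_mul, mul_one] at h
  rw [h]
  simpa using lieb_rpow_int m L hm hL 0 (omegaConst m)

lemma lieb_nu_fin (m : ℝ) (hm : 0 < m) : IsFiniteMeasureOnCompacts (liebNu m) := by
  refine ⟨fun K hK => ?_⟩
  obtain ⟨M, hM⟩ := hK.bddAbove
  have hsub : K ⊆ Set.Iic 0 ∪ Set.Ioo 0 (max M 0 + 1) := by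
    intro x hx
    by_cases h : x ≤ 0
    · exact Or.inl h
    · exact Or.inr ⟨not_le.1 h, by have := hM hx; have := le_max_left M 0; linarith⟩
  refine (measure_mono hsub).trans_lt ((measure_union_le _ _).trans_lt ?_)
  rw [lieb_nu_nonpos, zero_add]
  exact (lieb_nu_Ioo m _ hm (by positivity)).lt_top

def liebK (m L : ℝ) (ρ : ℝ) : ℝ := L / omegaConst m * ((ρ / 2) ^ (1 - m) + L ^ (1 - m))

lemma liebK_meas (m L : ℝ) : Measurable (fun ρ => ENNReal.ofReal (liebK m L ρ)) := by
  unfold liebK; fun_prop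

lemma liebK_int (m L : ℝ) (hm : 0 < m) (hL : 0 < L) :
    ∫⁻ t in Set.Ioo 0 L, ENNReal.ofReal (liebK m L t) ∂(liebNu m) ≠ ⊤ := by
  rw [lieb_nu_int m 0 L le_rfl _ (liebK_meas m L)]
  convert lieb_rpow_int m L hm hL (L * 2 ^ (m - 1)) (L * L ^ (1 - m)) using 1
  refine setLIntegral_congr_fun measurableSet_Ioo fun t ht => ?_
  have ho := lieb_omega_pos m hm
  have ht0 := ht.1
  rw [← ENNReal.ofReal_mul (by positivity)]
  congr 1
  unfold liebK
  rw [Real.div_rpow ht0.le (by norm_num), show (1 - m) = -(m - 1) by ring,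
    Real.rpow_neg ht0.le, Real.rpow_neg (by norm_num : (0:ℝ) ≤ 2)]
  have := Real.rpow_pos_of_pos ht0 (m - 1)
  have : (0:ℝ) < 2 ^ (m - 1) := by positivity
  field_simp

lemma liebK_ge (m L : ℝ) (hm : 0 < m) (hL : 0 < L) (a t : ℝ) (ha : 0 < a) (hat : a / 2 ≤ t)
    (htL : t ≤ L) : L ≤ liebK m L a * (omegaConst m * t ^ (m - 1)) := by
  have ho := lieb_omega_pos m hm
  have ht : 0 < t := by linarith
  have htp := Real.rpow_pos_of_pos ht (m - 1)
  have h1 : 1 ≤ ((a / 2) ^ (1 - m) + L ^ (1 - m)) * t ^ (m - 1) := by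
    have e1 : 0 < (a / 2) ^ (1 - m) := by positivity
    have e2 : 0 < L ^ (1 - m) := by positivity
    have e3 : t ^ (1 - m) * t ^ (m - 1) = 1 := by
      rw [← Real.rpow_add ht]; simp
    rcases le_total 1 m with h | h
    · have : t ^ (1 - m) ≤ (a / 2) ^ (1 - m) :=
        Real.rpow_le_rpow_of_nonpos (by positivity) hat (by linarith)
      nlinarith
    · have : t ^ (1 - m) ≤ L ^ (1 - m) :=
        Real.rpow_le_rpow ht.le htL (by linarith)
      nlinarith
  unfold liebK
  calc L = L * 1 := by ring
    _ ≤ L * (((a / 2) ^ (1 - m) + L ^ (1 - m)) * t ^ (m - 1)) := by gcongr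
    _ = _ := by field_simp

lemma lieb_grad (n : ℕ) (φ : ℝ × EuclideanSpace ℝ (Fin n) → ℝ) (hφ : ContDiff ℝ (⊤ : ℕ∞) φ)
    (z : ℝ × EuclideanSpace ℝ (Fin n)) :
    cylGradSq n (fun w => ((φ w : ℝ) : ℂ)) z = (fderiv ℝ φ z (1, 0)) ^ 2 +
      ∑ i : Fin n, (fderiv ℝ φ z (0, EuclideanSpace.single i 1)) ^ 2 := by
  have hd : HasFDerivAt φ (fderiv ℝ φ z) z := ((hφ.differentiable (by simp)) z).hasFDerivAt
  have h : fderiv ℝ (fun w => ((φ w : ℝ) : ℂ)) z = Complex.ofRealCLM.comp (fderiv ℝ φ z) :=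
    (Complex.ofRealCLM.hasFDerivAt.comp z hd).fderiv
  unfold cylGradSq
  simp [h]

lemma lieb_grad_cont (n : ℕ) (φ : ℝ × EuclideanSpace ℝ (Fin n) → ℝ)
    (hφ : ContDiff ℝ (⊤ : ℕ∞) φ) :
    Continuous (cylGradSq n (fun w => ((φ w : ℝ) : ℂ))) := by
  have h : Continuous (fderiv ℝ φ) := hφ.continuous_fderiv (by simp)
  rw [funext (lieb_grad n φ hφ)]
  fun_prop

lemma lieb_grad_supp (n : ℕ) (φ : ℝ × EuclideanSpace ℝ (Fin n) → ℝ)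
    (hφ : ContDiff ℝ (⊤ : ℕ∞) φ) (hs : HasCompactSupport φ) :
    HasCompactSupport (cylGradSq n (fun w => ((φ w : ℝ) : ℂ))) := by
  refine (hs.fderiv (𝕜 := ℝ)).mono fun z hz hz' => hz ?_
  rw [lieb_grad n φ hφ]
  simp [hz']

lemma lieb_sq (n : ℕ) (φ : ℝ × EuclideanSpace ℝ (Fin n) → ℝ) (ε : ℝ) (z w) :
    ENNReal.ofReal (max (φ z - ε / 2) 0 ^ 2) ≤ 2 * ENNReal.ofReal (max (φ w - ε / 2) 0 ^ 2) +
      2 * ENNReal.ofReal ((φ z - φ w) ^ 2) := by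
  rw [show (2 : ℝ≥0∞) = ENNReal.ofReal 2 by simp, ← ENNReal.ofReal_mul (by simp),
    ← ENNReal.ofReal_mul (by simp), ← ENNReal.ofReal_add (by positivity) (by positivity)]
  apply ENNReal.ofReal_le_ofReal
  have h : |max (φ z - ε / 2) 0 - max (φ w - ε / 2) 0| ≤ |φ z - φ w| := by
    simpa using abs_max_sub_max_le_abs (φ z - ε / 2) (φ w - ε / 2) 0
  have h2 := sq_le_sq.2 h
  nlinarith [sq_nonneg (max (φ z - ε / 2) 0 - 2 * max (φ w - ε / 2) 0)]

lemma lieb_hyp1 (m L : ℝ) (hm : 0 < m) (hL : 0 < L) (n : ℕ)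
    (φ : ℝ × EuclideanSpace ℝ (Fin n) → ℝ)
    (hφ : ContDiff ℝ (⊤ : ℕ∞) φ) (x : EuclideanSpace ℝ (Fin n)) (a : ℝ) (ha : a ∈ Set.Ioo 0 L)
    (b : ℝ) (hb : b ∈ Set.Ioo (L / 2) L) :
    ENNReal.ofReal ((φ (a, x) - φ (b, x)) ^ 2) ≤ ENNReal.ofReal (liebK m L a) *
      ∫⁻ t in Set.Ioo 0 L, ENNReal.ofReal (cylGradSq n (fun w => ((φ w : ℝ) : ℂ)) (t, x))
        ∂(liebNu m) := by
  have hfd : Continuous (fderiv ℝ φ) := hφ.continuous_fderiv (by simp)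
  have hder : ∀ t, HasDerivAt (fun t => φ (t, x)) (fderiv ℝ φ (t, x) (1, 0)) t := by
    intro t
    have hd : HasFDerivAt φ (fderiv ℝ φ (t, x)) (t, x) :=
      ((hφ.differentiable (by simp)) _).hasFDerivAt
    exact hd.comp_hasDerivAt t ((hasDerivAt_id t).prodMk (hasDerivAt_const t x))
  have hcont : Continuous (fun t : ℝ => fderiv ℝ φ (t, x) (1, 0)) := by fun_prop
  have hgm := (lieb_grad_cont n φ hφ).measurable
  have key : ∀ p q : ℝ, p ≤ q → a / 2 ≤ p → q < L →
      ENNReal.ofReal ((φ (q, x) - φ (p, x)) ^ 2) ≤ ENNReal.ofReal (liebK m L a) *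
      ∫⁻ t in Set.Ioo 0 L, ENNReal.ofReal (cylGradSq n (fun w => ((φ w : ℝ) : ℂ)) (t, x))
        ∂(liebNu m) := by
    intro p q hpq hp hq
    have ha0 := ha.1
    refine (lieb_ftc _ _ hder hcont p q hpq).trans ?_
    rw [lieb_nu_int m 0 L le_rfl _ (by fun_prop), ← lintegral_const_mul _ (by fun_prop),
      ← lintegral_const_mul _ (by fun_prop)]
    refine le_trans ?_ (lintegral_mono_set (s := Set.Ioc p q) fun t ht =>
      ⟨by linarith [ht.1], by linarith [ht.2]⟩)
    refine setLIntegral_mono' measurableSet_Ioc fun t ht => ?_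
    have h1 := liebK_ge m L hm hL a t ha0 (by linarith [ht.1]) (by linarith [ht.2])
    have ht0 : 0 < t := by linarith [ht.1]
    have ho := lieb_omega_pos m hm
    have hk : 0 ≤ liebK m L a := by unfold liebK; positivity
    have hw : 0 ≤ omegaConst m * t ^ (m - 1) := by positivity
    rw [← mul_assoc, ← ENNReal.ofReal_mul hk]
    have hg : fderiv ℝ φ (t, x) (1, 0) ^ 2 ≤
        cylGradSq n (fun w => ((φ w : ℝ) : ℂ)) (t, x) := by
      rw [lieb_grad n φ hφ]
      have : 0 ≤ ∑ i : Fin n, (fderiv ℝ φ (t, x) (0, EuclideanSpace.single i 1)) ^ 2 :=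
        Finset.sum_nonneg fun i _ => sq_nonneg _
      linarith
    gcongr
    linarith
  rcases le_total a b with h | h
  · rw [show (φ (a, x) - φ (b, x)) ^ 2 = (φ (b, x) - φ (a, x)) ^ 2 by ring]
    exact key a b h (by linarith [ha.1]) hb.2
  · exact key b a h (by linarith [ha.2, hb.1]) ha.2

lemma lieb_hyp2 (n : ℕ) (φ : ℝ × EuclideanSpace ℝ (Fin n) → ℝ)
    (hφ : ContDiff ℝ (⊤ : ℕ∞) φ) (a : ℝ) (x v : EuclideanSpace ℝ (Fin n)) :
    ENNReal.ofReal ((φ (a, x) - φ (a, x + v)) ^ 2) ≤ ENNReal.ofReal (‖v‖ ^ 2) *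
      ∫⁻ t in Set.Ioc (0:ℝ) 1,
        ENNReal.ofReal (cylGradSq n (fun w => ((φ w : ℝ) : ℂ)) (a, x + t • v)) := by
  have hfd : Continuous (fderiv ℝ φ) := hφ.continuous_fderiv (by simp)
  have hder : ∀ t : ℝ, HasDerivAt (fun t : ℝ => φ (a, x + t • v))
      (fderiv ℝ φ (a, x + t • v) (0, v)) t := by
    intro t
    have hd : HasFDerivAt φ (fderiv ℝ φ (a, x + t • v)) (a, x + t • v) :=
      ((hφ.differentiable (by simp)) _).hasFDerivAt
    have h2 : HasDerivAt (fun t : ℝ => x + t • v) v t := by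
      simpa using ((hasDerivAt_id t).smul_const v).const_add x
    exact hd.comp_hasDerivAt t ((hasDerivAt_const t a).prodMk h2)
  have hcont : Continuous (fun t : ℝ => fderiv ℝ φ (a, x + t • v) (0, v)) := by fun_prop
  have hgm := (lieb_grad_cont n φ hφ).measurable
  have := lieb_ftc _ _ hder hcont 0 1 zero_le_one
  simp only [one_smul, zero_smul, add_zero, sub_zero, ENNReal.ofReal_one, one_mul] at this
  rw [show (φ (a, x) - φ (a, x + v)) ^ 2 = (φ (a, x + v) - φ (a, x)) ^ 2 by ring]
  refine this.trans ?_
  rw [← lintegral_const_mul _ (by fun_prop)]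
  refine lintegral_mono fun t => ?_
  rw [← ENNReal.ofReal_mul (by positivity)]
  apply ENNReal.ofReal_le_ofReal
  set A := fderiv ℝ φ (a, x + t • v) with hA
  have hv : A (0, v) = ∑ i, v i * A (0, EuclideanSpace.single i 1) := by
    have e : v = ∑ i, v i • EuclideanSpace.single i (1:ℝ) := by
      ext j
      simp [Finset.sum_apply, Pi.single_apply]
    let A2 : EuclideanSpace ℝ (Fin n) →L[ℝ] ℝ := A.comp (ContinuousLinearMap.inr ℝ ℝ _)
    have hA2 : ∀ y, A (0, y) = A2 y := fun y => by simp [A2]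
    simp only [hA2]
    conv_lhs => rw [e]
    simp
  rw [lieb_grad n φ hφ, hv]
  have hcs := Finset.sum_mul_sq_le_sq_mul_sq Finset.univ (fun i => v i)
    (fun i => A (0, EuclideanSpace.single i 1))
  have hn : ‖v‖ ^ 2 = ∑ i, v i ^ 2 := by
    rw [EuclideanSpace.norm_sq_eq]; simp
  rw [hn]
  refine hcs.trans ?_
  gcongr
  have := sq_nonneg (A (1, 0))
  linarith

/-- **Quantitative translation step in Lieb's concentration compactness.** If the
nonnegative `φ_j` are uniformly bounded in `Ḣ¹` and carry mass `≥ δ` at level `ε`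
in the region `ρ ≤ R`, then after translating by suitable `x_j` they carry a fixed
amount `δ' > 0` of mass at level `ε/2` on the bounded region
`{ρ ≤ R + 1, |x − x_j| < 1}`. -/
theorem lieb_translation_step (m : ℝ) (n : ℕ) (hm : 0 < m) (hn : 2 ≤ n)
    (ε R δ B : ℝ) (hε : 0 < ε) (hδ : 0 < δ)
    (φ : ℕ → ℝ × EuclideanSpace ℝ (Fin n) → ℝ)
    (hφ_smooth : ∀ j, ContDiff ℝ (⊤ : ℕ∞) (φ j)) (hφ_supp : ∀ j, HasCompactSupport (φ j))
    (hφ_nonneg : ∀ j w, 0 ≤ φ j w)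
    (hbdd : ∀ j, cylH1Norm m n (fun w => ((φ j w : ℝ) : ℂ)) ≤ B)
    (hmass : ∀ j, ENNReal.ofReal δ ≤
      cylMeasure m n {w : ℝ × EuclideanSpace ℝ (Fin n) | ε < φ j w ∧ w.1 ≤ R}) :
    ∃ (δ' : ℝ) (x : ℕ → EuclideanSpace ℝ (Fin n)), 0 < δ' ∧
      ∀ j, ENNReal.ofReal δ' ≤
        cylMeasure m n {w : ℝ × EuclideanSpace ℝ (Fin n) |
          w.1 ≤ R + 1 ∧ ‖w.2 - x j‖ < 1 ∧ ε / 2 ≤ φ j w} := by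
  set L := R + 1 with hLdef
  have hnull : ∀ A : Set (ℝ × EuclideanSpace ℝ (Fin n)), (∀ z ∈ A, z.1 ≤ 0) →
      cylMeasure m n A = 0 := by
    intro A hA
    refine measure_mono_null (t := Set.Iic 0 ×ˢ Set.univ) (fun z hz => ⟨hA z hz, trivial⟩) ?_
    rw [lieb_cyl, Measure.prod_prod, lieb_nu_nonpos, zero_mul]
  have hδ' : ENNReal.ofReal δ ≠ 0 := by simpa using hδ
  have hL : 0 < L := by
    by_contra hcon
    have := hmass 0
    rw [hnull _ (fun z hz => by have := hz.2; linarith)] at this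
    exact hδ' (le_antisymm this zero_le)
  have := lieb_nu_fin m hm
  have : IsFiniteMeasureOnCompacts (cylMeasure m n) := by
    rw [lieb_cyl]; infer_instance
  let E := EuclideanSpace ℝ (Fin n)
  let F : ℕ → ℝ × E → ℝ≥0∞ := fun j z => ENNReal.ofReal (max (φ j z - ε / 2) 0 ^ 2)
  let H : ℕ → ℝ × E → ℝ≥0∞ := fun j z =>
    ENNReal.ofReal (cylGradSq n (fun w => ((φ j w : ℝ) : ℂ)) z)
  have hcF : ∀ j, Continuous (fun z => max (φ j z - ε / 2) 0 ^ 2) := fun j => by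
    have := (hφ_smooth j).continuous
    fun_prop
  have hF : ∀ j, Measurable (F j) := fun j => (hcF j).measurable.ennreal_ofReal
  have hH : ∀ j, Measurable (H j) := fun j =>
    (lieb_grad_cont n (φ j) (hφ_smooth j)).measurable.ennreal_ofReal
  have hFfin : ∀ j, ∫⁻ z, F j z ∂(cylMeasure m n) ≠ ⊤ := by
    intro j
    have hs : HasCompactSupport (fun z => max (φ j z - ε / 2) 0 ^ 2) := by
      refine (hφ_supp j).mono fun z hz hz' => hz ?_
      have h0 : φ j z = 0 := hz'
      have : max (0 - ε / 2) 0 = 0 := max_eq_right (by linarith)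
      simp only [h0, this]; norm_num
    exact ((hcF j).integrable_of_hasCompactSupport hs).lintegral_lt_top.ne
  have hHB : ∀ j, ∫⁻ z, H j z ∂(cylMeasure m n) ≤ ENNReal.ofReal (B ^ 2) := by
    intro j
    have hi := (lieb_grad_cont n (φ j) (hφ_smooth j)).integrable_of_hasCompactSupport
      (μ := cylMeasure m n) (lieb_grad_supp n (φ j) (hφ_smooth j) (hφ_supp j))
    rw [← ofReal_integral_eq_lintegral_ofReal hi (Filter.Eventually.of_forall fun z => by
      unfold cylGradSq
      positivity)]
    exact ENNReal.ofReal_le_ofReal (Real.sqrt_le_iff.1 (hbdd j)).2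
  set I := Set.Ioo (0:ℝ) L
  have hI : MeasurableSet I := measurableSet_Ioo
  set κ := ENNReal.ofReal ((ε / 2) ^ 2) * ENNReal.ofReal δ with hκ
  have hκ0 : κ ≠ 0 := mul_ne_zero (by simpa using by positivity) hδ'
  have hκt : κ ≠ ⊤ := ENNReal.mul_ne_top (by simp) (by simp)
  have hFlow : ∀ j, κ ≤ ∫⁻ z in I ×ˢ Set.univ, F j z ∂(cylMeasure m n) := by
    intro j
    set A := {w : ℝ × E | ε < φ j w ∧ w.1 ≤ R}
    have hA : MeasurableSet (A ∩ I ×ˢ Set.univ) :=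
      ((measurableSet_lt measurable_const (hφ_smooth j).continuous.measurable).inter
        (measurableSet_le measurable_fst measurable_const)).inter (hI.prod MeasurableSet.univ)
    have h1 : cylMeasure m n A ≤ cylMeasure m n (A ∩ I ×ˢ Set.univ) := by
      rw [← measure_inter_add_sdiff A (hI.prod MeasurableSet.univ), hnull (A \ _), add_zero]
      rintro z ⟨hz, hz'⟩
      by_contra hcon
      exact hz' ⟨⟨not_le.1 hcon, by have := hz.2; linarith⟩, trivial⟩
    calc κ ≤ ENNReal.ofReal ((ε / 2) ^ 2) * cylMeasure m n (A ∩ I ×ˢ Set.univ) := by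
          rw [hκ]; gcongr; exact (hmass j).trans h1
      _ = ∫⁻ z in A ∩ I ×ˢ Set.univ, ENNReal.ofReal ((ε / 2) ^ 2) ∂(cylMeasure m n) := by simp
      _ ≤ ∫⁻ z in A ∩ I ×ˢ Set.univ, F j z ∂(cylMeasure m n) := by
          refine setLIntegral_mono' hA fun z hz => ENNReal.ofReal_le_ofReal ?_
          have h2 : ε < φ j z := hz.1.1
          have h3 : ε / 2 ≤ max (φ j z - ε / 2) 0 := le_max_of_le_left (by linarith)
          gcongr
      _ ≤ _ := lintegral_mono_set Set.inter_subset_right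
  set K := ENNReal.ofReal (B ^ 2) / κ with hK
  have hKt : K ≠ ⊤ := ENNReal.div_ne_top (by simp) hκ0
  have hsel := fun j => lieb_select (liebNu m) (volume : Measure E) I hI K hKt (F j) (H j)
    (hF j) (hH j)
    (fun h => hκ0 (le_antisymm ((hFlow j).trans_eq h) zero_le))
    (ne_top_of_le_ne_top (hFfin j) (setLIntegral_le_lintegral _ _))
    (by
      calc _ ≤ _ := setLIntegral_le_lintegral _ _
        _ ≤ ENNReal.ofReal (B ^ 2) := hHB j
        _ = K * κ := (ENNReal.div_mul_cancel hκ0 hκt).symm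
        _ ≤ _ := by gcongr; exact hFlow j)
  choose x hx0 hx1 using hsel
  set C := (1 + K) * (volume : Measure E) (Metric.ball 0 2) /
    (volume : Measure E) (Metric.ball 0 1) + 1 with hC
  have hCt : C ≠ ⊤ := by
    refine ENNReal.add_ne_top.2 ⟨ENNReal.div_ne_top (ENNReal.mul_ne_top ?_
      measure_ball_lt_top.ne) (Metric.measure_ball_pos _ _ one_pos).ne', by simp⟩
    exact ENNReal.add_ne_top.2 ⟨by simp, hKt⟩
  have hC0 : C ≠ 0 := by simp [hC]
  have hJ0 : liebNu m (Set.Ioo (L / 2) L) ≠ 0 := by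
    have h := lieb_nu_int m (L / 2) L (by positivity) (fun _ => 1) measurable_const
    simp only [lintegral_const, Measure.restrict_apply_univ, one_mul, mul_one] at h
    rw [h, ← pos_iff_ne_zero, setLIntegral_pos_iff (lieb_w_meas m)]
    have hsub : Set.Ioo (L / 2) L ⊆ Function.support
        (fun ρ : ℝ => ENNReal.ofReal (omegaConst m * ρ ^ (m - 1))) ∩ Set.Ioo (L / 2) L := by
      intro t ht
      refine ⟨?_, ht⟩
      have ho := lieb_omega_pos m hm
      have ht0 : 0 < t := by linarith [ht.1]
      simp only [Function.mem_support, ne_eq, ENNReal.ofReal_eq_zero, not_le]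
      positivity
    refine lt_of_lt_of_le ?_ (measure_mono hsub)
    simp [Real.volume_Ioo]
    linarith
  have hJI : Set.Ioo (L / 2) L ⊆ I := Set.Ioo_subset_Ioo_left (by positivity)
  obtain ⟨s, hs0, hst, hs⟩ := lieb_abs3 (E := E) (liebNu m) (volume : Measure E) I
    (Set.Ioo (L / 2) L) hI measurableSet_Ioo hJI hJ0
    (ne_top_of_le_ne_top (lieb_nu_Ioo m L hm hL) (measure_mono hJI))
    (fun ρ => ENNReal.ofReal (liebK m L ρ)) (liebK_meas m L) (liebK_int m L hm hL)
    (C⁻¹ / 2) (by simp [hCt])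
  refine ⟨s.toReal, x, ENNReal.toReal_pos hs0 hst, fun j => ?_⟩
  rw [ENNReal.ofReal_toReal hst]
  by_contra hcon
  have hlt := not_le.1 hcon
  have hfin := hs (x j) (F j) (H j) (hF j) (hH j)
    (fun y a ha b hb => (lieb_sq n (φ j) ε (a, y) (b, y)).trans (by
      gcongr
      exact lieb_hyp1 m L hm hL n (φ j) (hφ_smooth j) y a ha b hb))
    (fun a y v => (lieb_sq n (φ j) ε (a, y) (a, y + v)).trans (by
      gcongr
      exact lieb_hyp2 n (φ j) (hφ_smooth j) a y v))
    (by
      refine lt_of_le_of_lt (measure_mono ?_) hlt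
      rintro z ⟨h1, h2, h3⟩
      refine ⟨h1.2.le, by simpa [dist_eq_norm] using h2, ?_⟩
      by_contra h4
      apply h3
      have : max (φ j z - ε / 2) 0 = 0 := max_eq_right (by linarith)
      simp only [F, this]; simp)
  set X := ∫⁻ z in I ×ˢ Metric.ball (x j) 1, F j z ∂((liebNu m).prod volume) with hX
  have hXt : X ≠ ⊤ := ne_top_of_le_ne_top (hFfin j) (setLIntegral_le_lintegral _ _)
  have h5 : X ≤ X / 2 := by
    calc X ≤ _ := hfin
      _ ≤ C⁻¹ / 2 * (C * X) := by gcongr; exact hx1 j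
      _ = (C⁻¹ * C) * (X / 2) := by simp only [div_eq_mul_inv]; ring
      _ = X / 2 := by rw [ENNReal.inv_mul_cancel hC0 hCt, one_mul]
  exact absurd h5 (not_le.2 (ENNReal.half_lt_self (hx0 j) hXt))
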